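/- Let G = (V,E,w) be a weighted connected graph with m = |E| edges, let v ∈ V, and let S ⊆ V be nonempty. Then for any two reals 0 ≤ λ < λ' there exists a real r ∈ [λ, λ') such that cost(∂C_S(r, v)) ≤ ((vol(C_S(r, v)) + τ)/(λ' − λ)) · max[1, log_2((m + τ)/(vol(E(C_S(λ, v))) + τ))], where τ = 1 if vol(E(C_S(λ, v))) = 0 and τ = 0 otherwise. -/

import Mathlib

open scoped Classical

structure WGraph (V : Type) (E : Type) where
  ends : E → V × V
  w : E → ℝ
  w_pos : ∀ e, 0 < w e

namespace WGraph

variable {V E : Type}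

/-- The length of an edge is the reciprocal of its weight. -/
noncomputable def len (G : WGraph V E) (e : E) : ℝ := 1 / G.w e

/-- A walk in a multigraph, recorded as a sequence of edge traversals. -/
inductive Walk (G : WGraph V E) : V → V → Type
  | nil (v : V) : Walk G v v
  | cons (u v x : V) (e : E)
      (h : G.ends e = (u, v) ∨ G.ends e = (v, u))
      (p : Walk G v x) : Walk G u x

/-- The length of a walk: the sum of the lengths of its edges. -/
noncomputable def Walk.length {G : WGraph V E} : ∀ {u v : V}, G.Walk u v → ℝ
  | _, _, .nil _ => 0
  | _, _, .cons _ _ _ e _ p => G.len e + Walk.length p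

/-- The list of vertices visited by a walk. -/
def Walk.support {G : WGraph V E} : ∀ {u v : V}, G.Walk u v → List V
  | _, _, .nil v => [v]
  | _, _, .cons u _ _ _ _ p => u :: Walk.support p

def Connected (G : WGraph V E) : Prop := ∀ u v : V, Nonempty (G.Walk u v)

/-- Shortest-path distance. -/
noncomputable def dist (G : WGraph V E) (u v : V) : ℝ :=
  sInf {l | ∃ p : G.Walk u v, p.length = l}

/-- Shortest-path distance inside the subgraph induced on `A`. -/
noncomputable def distOn (G : WGraph V E) (A : Set V) (u v : V) : ℝ :=
  sInf {l | ∃ p : G.Walk u v, (∀ z ∈ p.support, z ∈ A) ∧ p.length = l}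

/-- The distance from a vertex to a set of vertices. -/
noncomputable def distToSet (G : WGraph V E) (u : V) (S : Set V) : ℝ :=
  sInf {l | ∃ s ∈ S, G.dist u s = l}

/-- The distance from a vertex to a set, within the subgraph induced on `A`. -/
noncomputable def distToSetOn (G : WGraph V E) (A : Set V) (u : V) (S : Set V) : ℝ :=
  sInf {l | ∃ s ∈ S, G.distOn A u s = l}

/-- radius(G,x): the smallest `r` such that every vertex is within distance `r` of `x`. -/
noncomputable def radius (G : WGraph V E) (x : V) : ℝ :=
  sInf {r | ∀ v : V, G.dist x v ≤ r}

/-- The radius of the subgraph induced on `A`, about `x`. -/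
noncomputable def radiusOn (G : WGraph V E) (A : Set V) (x : V) : ℝ :=
  sInf {r | ∀ v ∈ A, G.distOn A x v ≤ r}

/-- The subgraph induced on `A` is connected. -/
def ConnectedOn (G : WGraph V E) (A : Set V) : Prop :=
  ∀ u ∈ A, ∀ v ∈ A, ∃ p : G.Walk u v, ∀ z ∈ p.support, z ∈ A

/-- The spanning subgraph with edge set `T`. -/
def restrictE (G : WGraph V E) (T : Set E) : WGraph V T where
  ends e := G.ends e.1
  w e := G.w e.1
  w_pos e := G.w_pos e.1

/-- `T` is the edge set of a spanning tree of `G` (a subgraph of `G`). -/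
def IsSpanningTree [Fintype V] (G : WGraph V E) (T : Finset E) : Prop :=
  (G.restrictE (T : Set E)).Connected ∧ T.card + 1 = Fintype.card V

/-- stretch_T(u,v) = dist_T(u,v)/d(u,v) for the edge e = (u,v). -/
noncomputable def stretch (G : WGraph V E) (T : Finset E) (e : E) : ℝ :=
  (G.restrictE (T : Set E)).dist (G.ends e).1 (G.ends e).2 / G.len e

/-- The average stretch over all edges. -/
noncomputable def avestretch [Fintype E] (G : WGraph V E) (T : Finset E) : ℝ :=
  (∑ e : E, G.stretch T e) / (Fintype.card E : ℝ)

/-- The Alon–Karp–Peleg–West stretch: dist_T(u,v)/dist_G(u,v). -/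
noncomputable def stretchAKPW (G : WGraph V E) (T : Finset E) (e : E) : ℝ :=
  (G.restrictE (T : Set E)).dist (G.ends e).1 (G.ends e).2 /
    G.dist (G.ends e).1 (G.ends e).2

/-- The average AKPW stretch over all edges. -/
noncomputable def avestretchAKPW [Fintype E] (G : WGraph V E) (T : Finset E) : ℝ :=
  (∑ e : E, G.stretchAKPW T e) / (Fintype.card E : ℝ)

/-- The ball of radius `r` around `x`. -/
def ball (G : WGraph V E) (r : ℝ) (x : V) : Set V := {v | G.dist x v ≤ r}

/-- The ball shell of radius `r` around `x`. -/
def ballShell (G : WGraph V E) (r : ℝ) (x : V) : Set V :=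
  {u | u ∉ G.ball r x ∧ ∃ e : E, ∃ z ∈ G.ball r x,
    (G.ends e = (u, z) ∨ G.ends e = (z, u)) ∧ G.dist x u = G.dist x z + G.len e}

/-- The set of edges with exactly one endpoint in `S`. -/
def bdry (G : WGraph V E) (S : Set V) : Set E :=
  {e | ((G.ends e).1 ∈ S ∧ (G.ends e).2 ∉ S) ∨ ((G.ends e).1 ∉ S ∧ (G.ends e).2 ∈ S)}

/-- The set of edges with both endpoints in `S`. -/
def edgesIn (G : WGraph V E) (S : Set V) : Set E :=
  {e | (G.ends e).1 ∈ S ∧ (G.ends e).2 ∈ S}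

/-- The set of edges with one endpoint in `S` and the other in `T`. -/
def edgesBetween (G : WGraph V E) (S T : Set V) : Set E :=
  {e | ((G.ends e).1 ∈ S ∧ (G.ends e).2 ∈ T) ∨ ((G.ends e).1 ∈ T ∧ (G.ends e).2 ∈ S)}

/-- vol(S): the number of edges with at least one endpoint in `S`. -/
noncomputable def volV (G : WGraph V E) (S : Set V) : ℕ :=
  {e : E | (G.ends e).1 ∈ S ∨ (G.ends e).2 ∈ S}.ncard

/-- cost(F): the sum of the weights of the edges in `F`. -/
noncomputable def cost [Fintype E] (G : WGraph V E) (F : Set E) : ℝ :=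
  ∑ e : E, F.indicator G.w e

/-- A star-decomposition of `G` with center `x0`, parts `P i`, anchors `x i`,
`y i ∈ P 0`, and bridge edges `b i` for `i ≠ 0`. -/
structure IsStarDecomp (G : WGraph V E) (x0 : V) (k : ℕ)
    (P : Fin (k + 1) → Set V) (x y : Fin (k + 1) → V)
    (b : Fin (k + 1) → E) : Prop where
  disj : ∀ i j, i ≠ j → Disjoint (P i) (P j)
  cover : ⋃ i, P i = Set.univ
  center : x0 ∈ P 0
  conn : ∀ i, G.ConnectedOn (P i)
  anchor : ∀ i, x i ∈ P i
  x0eq : x 0 = x0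
  bridge : ∀ i, i ≠ 0 → y i ∈ P 0 ∧
    (G.ends (b i) = (x i, y i) ∨ G.ends (b i) = (y i, x i))

/-- A (δ,ε)-star-decomposition. -/
def IsStarDecompDE (G : WGraph V E) (x0 : V) (δ ε : ℝ) (k : ℕ)
    (P : Fin (k + 1) → Set V) (x y : Fin (k + 1) → V)
    (b : Fin (k + 1) → E) : Prop :=
  G.IsStarDecomp x0 k P x y b ∧
  δ * G.radius x0 ≤ G.radiusOn (P 0) x0 ∧
  G.radiusOn (P 0) x0 ≤ (1 - δ) * G.radius x0 ∧
  ∀ i, i ≠ 0 →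
    G.radiusOn (P 0) x0 + G.len (b i) + G.radiusOn (P i) (x i) ≤
      (1 + ε) * G.radius x0

/-- A concentric system in `G` (indexed by nonnegative radii). -/
structure IsConcentric (G : WGraph V E) (L : ℝ → Set V) : Prop where
  nonempty : (L 0).Nonempty
  mono : ∀ r r' : ℝ, 0 ≤ r → r < r' → L r ⊆ L r'
  closed : ∀ r : ℝ, 0 ≤ r → ∀ e : E,
    ((G.ends e).1 ∈ L r → (G.ends e).2 ∈ L (r + G.len e)) ∧
    ((G.ends e).2 ∈ L r → (G.ends e).1 ∈ L (r + G.len e))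

/-- The total length of the traversals of a walk that are not forward
(with respect to `S`). -/
noncomputable def Walk.coneCost {G : WGraph V E} (S : Set V) :
    ∀ {u v : V}, G.Walk u v → ℝ
  | _, _, .nil _ => 0
  | _, _, .cons a c _ e _ p =>
      (if G.distToSet a S + G.len e = G.distToSet c S then 0 else G.len e) +
        Walk.coneCost S p

/-- The cone of width `l` around `v` induced by `S`. -/
def cone (G : WGraph V E) (S : Set V) (l : ℝ) (v : V) : Set V :=
  {u | ∃ p : G.Walk v u, Walk.coneCost S p ≤ l}

/-- `coneCost` computed within the subgraph induced on `A`. -/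
noncomputable def Walk.coneCostOn {G : WGraph V E} (A S : Set V) :
    ∀ {u v : V}, G.Walk u v → ℝ
  | _, _, .nil _ => 0
  | _, _, .cons a c _ e _ p =>
      (if G.distToSetOn A a S + G.len e = G.distToSetOn A c S then 0 else G.len e) +
        Walk.coneCostOn A S p

/-- The cone of width `l` around `v` induced by `S`, computed in the subgraph
induced on `A`. -/
def coneOn (G : WGraph V E) (A S : Set V) (l : ℝ) (v : V) : Set V :=
  {u | ∃ p : G.Walk v u, (∀ z ∈ p.support, z ∈ A) ∧ Walk.coneCostOn A S p ≤ l}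

end WGraph

open Finset in
/-- A ball-growing argument: if the interval `[a i, b i)` has length at most `1 / w i`, then some
radius `r` crosses intervals of small total weight relative to the number of `i` with `a i ≤ r`. -/
theorem exists_sum_crossing_le {ι : Type*} [Fintype ι] (a b w : ι → ℝ)
    (hab : ∀ i, a i ≤ b i) (hw : ∀ i, 0 < w i) (hlen : ∀ i, w i * (b i - a i) ≤ 1)
    {lam lam' τ : ℝ} (hlt : lam < lam')
    (hpos : 0 < (#{i | b i ≤ lam} : ℝ) + τ) :
    ∃ r : ℝ, lam ≤ r ∧ r < lam' ∧
      ∑ i with a i ≤ r ∧ r < b i, w i ≤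
        ((#{i | a i ≤ r} : ℝ) + τ) / (lam' - lam) *
          max 1 (Real.logb 2 (((Fintype.card ι : ℝ) + τ) / ((#{i | b i ≤ lam} : ℝ) + τ))) := by
  by_contra! H
  set A : ℝ := (#{i | b i ≤ lam} : ℝ) + τ with hA
  set M : ℝ := max 1 (Real.logb 2 (((Fintype.card ι : ℝ) + τ) / A))
  have hΔ : 0 < lam' - lam := sub_pos.2 hlt
  have hM : 0 < M := lt_of_lt_of_le one_pos (le_max_left _ _)
  -- `F r` is `A` plus the integral of the crossing weight over `[lam, r]`.
  set F : ℝ → ℝ := fun r => A + ∑ i, w i *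
    ((min r (b i) - min lam (b i)) - (min r (a i) - min lam (a i))) with hF
  have hmin (x c : ℝ) :
      HasDerivWithinAt (fun r => min r c) (if x < c then 1 else 0) (Set.Ici x) x := by
    split_ifs with h
    · refine ((hasDerivAt_id x).congr_of_eventuallyEq ?_).hasDerivWithinAt
      filter_upwards [Iio_mem_nhds h] with y hy
      exact min_eq_left (le_of_lt hy)
    · refine (hasDerivWithinAt_const x (Set.Ici x) c).congr (fun y hy => ?_) ?_
      · exact min_eq_right ((not_lt.1 h).trans hy)
      · exact min_eq_right (not_lt.1 h)
  have hFderiv (x : ℝ) :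
      HasDerivWithinAt F (∑ i with a i ≤ x ∧ x < b i, w i) (Set.Ici x) x := by
    have h := (HasDerivWithinAt.fun_sum (u := Finset.univ) fun i _ =>
      (((hmin x (b i)).sub_const (min lam (b i))).fun_sub
        ((hmin x (a i)).sub_const (min lam (a i)))).const_mul (w i)).const_add A
    refine h.congr_deriv ?_
    rw [Finset.sum_filter]
    refine Finset.sum_congr rfl fun i _ => ?_
    have := hab i
    split_ifs <;> grind
  have hFle (x : ℝ) (hx : lam ≤ x) : F x ≤ (#{i | a i ≤ x} : ℝ) + τ := by
    have key : (#{i | b i ≤ lam} : ℝ) + ∑ i, w i *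
        ((min x (b i) - min lam (b i)) - (min x (a i) - min lam (a i))) ≤
          (#{i | a i ≤ x} : ℝ) := by
      rw [Finset.natCast_card_filter, Finset.natCast_card_filter, ← Finset.sum_add_distrib]
      refine Finset.sum_le_sum fun i _ => ?_
      have h1 := hab i
      have h2 := hw i
      have h3 := hlen i
      by_cases hb : b i ≤ lam
      · have hx1 : a i ≤ lam := h1.trans hb
        simp [hb, hx1, hx1.trans hx, hb.trans hx]
      · by_cases ha : a i ≤ x
        · simp only [hb, ha, if_true, if_false, zero_add]
          refine (mul_le_mul_of_nonneg_left ?_ h2.le).trans h3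
          have := min_le_right x (b i)
          have := min_le_min_left lam h1
          rw [min_eq_right ha]
          linarith
        · push Not at ha hb
          simp [ha.le, hb.le, not_le.2 hb, not_le.2 ha, (ha.trans_le h1).le, (hx.trans_lt ha).le]
    simp only [hF, hA]
    linarith
  have hcomp : A * Real.exp (M / (lam' - lam) * (lam' - lam)) ≤ F lam' := by
    have hB (x : ℝ) : HasDerivAt (fun r => -(A * Real.exp (M / (lam' - lam) * (r - lam))))
        (-(A * (Real.exp (M / (lam' - lam) * (x - lam)) * (M / (lam' - lam) * 1)))) x :=
      (((((hasDerivAt_id x).sub_const lam).const_mul (M / (lam' - lam))).exp).const_mul A).fun_neg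
    have hcont : ContinuousOn (fun r => -F r) (Set.Icc lam lam') := by
      simp only [hF]
      fun_prop
    have h := image_le_of_deriv_right_lt_deriv_boundary hcont
      (fun x _ => (hFderiv x).fun_neg) (by simp [hF]) hB (fun x hx hxB => ?_)
      (Set.right_mem_Icc.2 hlt.le)
    · linarith
    · have h1 := H x hx.1 hx.2
      have h2 : F x * (M / (lam' - lam)) ≤
          ((#{i | a i ≤ x} : ℝ) + τ) * (M / (lam' - lam)) :=
        mul_le_mul_of_nonneg_right (hFle x hx.1) (div_pos hM hΔ).le
      have h3 : ((#{i | a i ≤ x} : ℝ) + τ) / (lam' - lam) * M =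
          ((#{i | a i ≤ x} : ℝ) + τ) * (M / (lam' - lam)) := by ring
      have h4 : F x = A * Real.exp (M / (lam' - lam) * (x - lam)) := neg_injective hxB
      rw [h4] at h2
      rw [h3] at h1
      linarith
  rw [div_mul_cancel₀ _ hΔ.ne'] at hcomp
  have hcard : (#{i | a i ≤ lam'} : ℝ) ≤ Fintype.card ι := by
    exact_mod_cast Finset.card_le_univ _
  have hR : Real.exp M ≤ ((Fintype.card ι : ℝ) + τ) / A := by
    rw [le_div_iff₀ hpos]
    linarith [hFle lam' hlt.le]
  have hRpos := (Real.exp_pos M).trans_le hR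
  have hlog : M ≤ Real.log (((Fintype.card ι : ℝ) + τ) / A) := (Real.le_log_iff_exp_le hRpos).2 hR
  have hlogb : Real.logb 2 (((Fintype.card ι : ℝ) + τ) / A) ≤ M := le_max_right _ _
  have hlog2 : Real.log 2 < 1 := Real.log_two_lt_d9.trans (by norm_num)
  rw [Real.logb, div_le_iff₀ (Real.log_pos one_lt_two)] at hlogb
  nlinarith

namespace WGraph

variable {V E : Type} {G : WGraph V E}

theorem len_pos (G : WGraph V E) (e : E) : 0 < G.len e := one_div_pos.2 (G.w_pos e)

theorem Walk.coneCost_mem_closure (S : Set V) {u v : V} (p : G.Walk u v) :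
    p.coneCost S ∈ AddSubmonoid.closure (Set.range G.len) := by
  induction p with
  | nil => exact zero_mem _
  | cons a c x e h p ih =>
    refine add_mem ?_ ih
    split_ifs
    · exact zero_mem _
    · exact AddSubmonoid.subset_closure ⟨e, rfl⟩

theorem Walk.exists_snoc (S : Set V) {u x y : V} (p : G.Walk u x) (e : E)
    (he : G.ends e = (x, y) ∨ G.ends e = (y, x)) :
    ∃ q : G.Walk u y, q.coneCost S ≤ p.coneCost S + G.len e := by
  induction p with
  | nil x =>
    refine ⟨.cons x y y e he (.nil y), ?_⟩
    have := G.len_pos e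
    simp only [Walk.coneCost]
    split_ifs <;> linarith
  | cons a c x e' h p ih =>
    obtain ⟨q, hq⟩ := ih he
    refine ⟨.cons a c y e' h q, ?_⟩
    simp only [Walk.coneCost]
    linarith

/-- The least cone cost of a walk from `v` to `u` is attained. -/
theorem exists_forall_mem_cone_iff [Finite E] (hG : G.Connected) (S : Set V) (v u : V) :
    ∃ ρ : ℝ, ∀ r, u ∈ G.cone S r v ↔ ρ ≤ r := by
  set T : Set ℝ := Set.range fun p : G.Walk v u => p.coneCost S
  have hT : T.IsWF := by
    refine (Set.IsPWO.mono (Set.IsPWO.addSubmonoid_closure ?_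
      (Set.finite_range G.len).isPWO) ?_).isWF
    · rintro _ ⟨e, rfl⟩
      exact (G.len_pos e).le
    · rintro _ ⟨p, rfl⟩
      exact p.coneCost_mem_closure S
  have hne : T.Nonempty := (hG v u).elim fun p => ⟨_, p, rfl⟩
  obtain ⟨p, hp⟩ := hT.min_mem hne
  refine ⟨hT.min hne, fun r => ⟨?_, fun h => ⟨p, hp.trans_le h⟩⟩⟩
  rintro ⟨q, hq⟩
  exact (hT.min_le hne ⟨q, rfl⟩).trans hq

theorem mem_cone_add_len (S : Set V) (v : V) {x y : V} {r : ℝ} (e : E)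
    (he : G.ends e = (x, y) ∨ G.ends e = (y, x)) (hx : x ∈ G.cone S r v) :
    y ∈ G.cone S (r + G.len e) v := by
  obtain ⟨p, hp⟩ := hx
  obtain ⟨q, hq⟩ := p.exists_snoc S e he
  exact ⟨q, by linarith⟩

end WGraph

/-- Cone cutting: for `0 ≤ λ < λ'` there is `r ∈ [λ, λ')` with
`cost(∂C_S(r,v)) ≤ ((vol(C_S(r,v))+τ)/(λ'−λ)) ·
  max(1, log₂((m+τ)/(vol(E(C_S(λ,v)))+τ)))`. -/
theorem cone_cutting (V E : Type) [Fintype V] [Fintype E] (G : WGraph V E)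
    (hG : G.Connected) (v : V) (S : Set V) (hS : S.Nonempty)
    (lam lam' : ℝ) (h0 : 0 ≤ lam) (hlt : lam < lam')
    (τ : ℝ) (hτ : τ = if (G.edgesIn (G.cone S lam v)).ncard = 0 then 1 else 0) :
    ∃ r : ℝ, lam ≤ r ∧ r < lam' ∧
      G.cost (G.bdry (G.cone S r v)) ≤
        ((G.volV (G.cone S r v) : ℝ) + τ) / (lam' - lam) *
          max 1 (Real.logb 2
            (((Fintype.card E : ℝ) + τ) /
              (((G.edgesIn (G.cone S lam v)).ncard : ℝ) + τ))) := by
  choose ρ hρ using WGraph.exists_forall_mem_cone_iff hG S v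
  set a : E → ℝ := fun e => min (ρ (G.ends e).1) (ρ (G.ends e).2)
  set b : E → ℝ := fun e => max (ρ (G.ends e).1) (ρ (G.ends e).2)
  have hlen (e : E) : G.w e * (b e - a e) ≤ 1 := by
    have h1 := (hρ _ _).1 (WGraph.mem_cone_add_len S v e (Or.inl rfl)
      ((hρ (G.ends e).1 _).2 le_rfl))
    have h2 := (hρ _ _).1 (WGraph.mem_cone_add_len S v e (Or.inr rfl)
      ((hρ (G.ends e).2 _).2 le_rfl))
    have h3 : b e - a e ≤ G.len e := by
      rw [max_sub_min_eq_abs, abs_le]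
      constructor <;> linarith
    calc G.w e * (b e - a e) ≤ G.w e * G.len e := mul_le_mul_of_nonneg_left h3 (G.w_pos e).le
      _ = 1 := mul_one_div_cancel (G.w_pos e).ne'
  have hin (r : ℝ) : (G.edgesIn (G.cone S r v)).ncard = (Finset.univ.filter (b · ≤ r)).card := by
    rw [← Set.ncard_coe_finset]
    congr 1
    ext e
    simp [WGraph.edgesIn, hρ, b]
  have hvol (r : ℝ) : G.volV (G.cone S r v) = (Finset.univ.filter (a · ≤ r)).card := by
    rw [← Set.ncard_coe_finset, WGraph.volV]
    congr 1
    ext e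
    simp [hρ, a]
  have hcost (r : ℝ) : G.cost (G.bdry (G.cone S r v)) =
      ∑ e with a e ≤ r ∧ r < b e, G.w e := by
    rw [WGraph.cost, Finset.sum_filter]
    refine Finset.sum_congr rfl fun e _ => ?_
    rw [Set.indicator_apply]
    refine if_congr ?_ rfl rfl
    simp only [WGraph.bdry, Set.mem_ofPred_eq, hρ, not_le, a, b, min_le_iff, lt_max_iff]
    grind
  have hpos : 0 < ((G.edgesIn (G.cone S lam v)).ncard : ℝ) + τ := by
    rw [hτ]
    split_ifs with h
    · positivity
    · rw [add_zero]
      exact_mod_cast Nat.pos_of_ne_zero h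
  rw [hin] at hpos
  simp only [hcost, hvol, hin]
  exact exists_sum_crossing_le a b G.w (fun _ => min_le_max) G.w_pos hlen hlt hpos
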